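/- Let A be a C*-algebra and let I_σ(A) denote the set of closed two-sided ideals of A that contain a full element. Then I_σ(A), with addition given by I+J, order given by inclusion, and zero element {0}, is an abstract Cuntz semigroup: (1) every increasing sequence in I_σ(A) has a supremum in I_σ(A) (the closure of the union); (2) every element is the supremum of a sequence (I_n) with I_n way-below I_{n+1}; (3) the way-below relation is compatible with addition; (4) suprema of increasing sequences are compatible with addition. -/

import Mathlib

variable {A : Type*} [NonUnitalCStarAlgebra A]

/-- The closed two-sided ideal of `A` generated by a set. -/
def genClosedIdeal (s : Set A) : TwoSidedIdeal A :=
  sInf {J : TwoSidedIdeal A | IsClosed (J : Set A) ∧ s ⊆ J}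

/-- Membership in `I_σ(A)`: a closed two-sided ideal containing a full element. -/
def MemIdealSigma (I : TwoSidedIdeal A) : Prop :=
  IsClosed (I : Set A) ∧ ∃ a ∈ I, genClosedIdeal {a} = I

/-- The supremum (in the lattice of closed ideals) of a sequence of ideals: the smallest
closed ideal containing the union, i.e. the closure of the sum. -/
def cSup (f : ℕ → TwoSidedIdeal A) : TwoSidedIdeal A :=
  genClosedIdeal (⋃ n, (f n : Set A))

/-- The sum `I + J` in the lattice of closed ideals. -/
def cAdd (I J : TwoSidedIdeal A) : TwoSidedIdeal A :=
  genClosedIdeal ((I : Set A) ∪ (J : Set A))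

/-- The way-below relation on `I_σ(A)`: `x ≪ y` iff for every increasing sequence in
`I_σ(A)` whose supremum dominates `y` there is `n` with `x ≤ z_n`. -/
def WayBelow (x y : TwoSidedIdeal A) : Prop :=
  ∀ g : ℕ → TwoSidedIdeal A, (∀ n, MemIdealSigma (g n)) → Monotone g →
    y ≤ cSup g → ∃ n, x ≤ g n

open TwoSidedIdeal Filter Topology

lemma isClosed_genClosedIdeal (s : Set A) : IsClosed (genClosedIdeal s : Set A) := by
  have h : (genClosedIdeal s : Set A) =
      ⋂ J ∈ {J : TwoSidedIdeal A | IsClosed (J : Set A) ∧ s ⊆ J}, (J : Set A) := by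
    ext x
    simp only [genClosedIdeal, SetLike.mem_coe, mem_sInf, Set.mem_iInter]
  rw [h]
  exact isClosed_biInter fun J hJ ↦ hJ.1

lemma subset_genClosedIdeal (s : Set A) : s ⊆ (genClosedIdeal s : Set A) := by
  intro x hx
  simp only [genClosedIdeal, SetLike.mem_coe, mem_sInf]
  exact fun J hJ ↦ hJ.2 hx

lemma genClosedIdeal_le {s : Set A} {J : TwoSidedIdeal A} (hJ : IsClosed (J : Set A))
    (hs : s ⊆ J) : genClosedIdeal s ≤ J :=
  sInf_le ⟨hJ, hs⟩

lemma mem_genClosedIdeal_singleton (a : A) : a ∈ genClosedIdeal {a} :=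
  subset_genClosedIdeal {a} rfl

lemma genClosedIdeal_singleton_le {a : A} {J : TwoSidedIdeal A} (hJ : IsClosed (J : Set A))
    (ha : a ∈ J) : genClosedIdeal {a} ≤ J :=
  genClosedIdeal_le hJ (Set.singleton_subset_iff.2 ha)

lemma memIdealSigma_genClosedIdeal_singleton (a : A) : MemIdealSigma (genClosedIdeal {a}) :=
  ⟨isClosed_genClosedIdeal _, a, mem_genClosedIdeal_singleton a, rfl⟩

lemma le_cSup (f : ℕ → TwoSidedIdeal A) (n : ℕ) : f n ≤ cSup f :=
  fun _ hx ↦ subset_genClosedIdeal _ (Set.mem_iUnion.2 ⟨n, hx⟩)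

lemma cSup_le {f : ℕ → TwoSidedIdeal A} {J : TwoSidedIdeal A} (hJ : IsClosed (J : Set A))
    (h : ∀ n, f n ≤ J) : cSup f ≤ J :=
  genClosedIdeal_le hJ (Set.iUnion_subset fun n ↦ h n)

lemma le_cAdd_left (I J : TwoSidedIdeal A) : I ≤ cAdd I J :=
  fun _ hx ↦ subset_genClosedIdeal _ (Or.inl hx)

lemma le_cAdd_right (I J : TwoSidedIdeal A) : J ≤ cAdd I J :=
  fun _ hx ↦ subset_genClosedIdeal _ (Or.inr hx)

lemma cAdd_le {I J K : TwoSidedIdeal A} (hK : IsClosed (K : Set A)) (hI : I ≤ K) (hJ : J ≤ K) :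
    cAdd I J ≤ K :=
  genClosedIdeal_le hK (Set.union_subset hI hJ)

/-- The supremum of an increasing sequence of ideals is the closure of its union. -/
lemma mem_closure_iUnion_of_mem_cSup {f : ℕ → TwoSidedIdeal A} (hf : Monotone f) {x : A}
    (hx : x ∈ cSup f) : x ∈ closure (⋃ n, (f n : Set A)) := by
  have hmul {s : A → A} (hs : Continuous s) (h : ∀ n, ∀ y ∈ f n, s y ∈ f n) {y : A}
      (hy : y ∈ closure (⋃ n, (f n : Set A))) : s y ∈ closure (⋃ n, (f n : Set A)) := by
    refine map_mem_closure hs hy fun z hz ↦ ?_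
    obtain ⟨n, hn⟩ := Set.mem_iUnion.1 hz
    exact Set.mem_iUnion.2 ⟨n, h n z hn⟩
  let J : TwoSidedIdeal A := TwoSidedIdeal.mk' (closure (⋃ n, (f n : Set A)))
    (subset_closure (Set.mem_iUnion.2 ⟨0, (f 0).zero_mem⟩))
    (fun {y z} hy hz ↦ by
      refine map_mem_closure₂ continuous_add hy hz fun a ha b hb ↦ ?_
      obtain ⟨n, hn⟩ := Set.mem_iUnion.1 ha
      obtain ⟨m, hm⟩ := Set.mem_iUnion.1 hb
      exact Set.mem_iUnion.2 ⟨max n m, (f _).add_mem (hf (le_max_left n m) hn)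
        (hf (le_max_right n m) hm)⟩)
    (fun hy ↦ hmul continuous_neg (fun n y hy ↦ (f n).neg_mem hy) hy)
    (fun {a _} hy ↦ hmul (continuous_const_mul a) (fun n y hy ↦ (f n).mul_mem_left a y hy) hy)
    (fun {_ a} hy ↦ hmul (continuous_mul_const a) (fun n y hy ↦ (f n).mul_mem_right y a hy) hy)
  have hJ : (J : Set A) = closure (⋃ n, (f n : Set A)) := TwoSidedIdeal.coe_mk' ..
  have h : cSup f ≤ J := genClosedIdeal_le (hJ ▸ isClosed_closure) (hJ ▸ subset_closure)
  exact hJ ▸ h hx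

/-- If `y` acts on `x` as if it were invertible, up to a small perturbation in a closed ideal,
then `x` lies in that ideal. -/
lemma mem_of_mul_mul_eq_self {J : TwoSidedIdeal A} (hJ : IsClosed (J : Set A)) {x y k b : A}
    (h : x * y * k = x) (hb : b ∈ J) (hlt : ‖y - b‖ * ‖k‖ < 1) : x ∈ J := by
  obtain ⟨d, hd⟩ : ∃ d, d = (y - b) * k := ⟨_, rfl⟩
  have hdn : ‖d‖ < 1 := hd ▸ (norm_mul_le _ _).trans_lt hlt
  have hstep : x - x * d ∈ J := by
    have : x - x * d = x * b * k := by
      rw [hd, sub_mul, mul_sub, ← mul_assoc, ← mul_assoc, h, sub_sub_cancel]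
    rw [this]
    exact J.mul_mem_right _ _ (J.mul_mem_left _ _ hb)
  let u : ℕ → A := fun n ↦ (· * d)^[n] x
  have hu (n : ℕ) : u (n + 1) = u n * d := Function.iterate_succ_apply' ..
  have hmem (n : ℕ) : x - u n ∈ J := by
    induction n with
    | zero => simp [u]
    | succ n ih =>
      have : x - u (n + 1) = (x - x * d) + (x - u n) * d := by rw [hu, sub_mul]; abel
      rw [this]
      exact J.add_mem hstep (J.mul_mem_right _ _ ih)
  have hnorm (n : ℕ) : ‖u n‖ ≤ ‖x‖ * ‖d‖ ^ n := by
    induction n with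
    | zero => simp [u]
    | succ n ih =>
      rw [hu, pow_succ, ← mul_assoc]
      exact (norm_mul_le _ _).trans (by gcongr)
  have hlim : Tendsto (fun n ↦ x - u n) atTop (𝓝 x) := by
    have h0 : Tendsto u atTop (𝓝 0) := squeeze_zero_norm hnorm <| by
      simpa using (tendsto_pow_atTop_nhds_zero_of_lt_one (norm_nonneg d) hdn).const_mul ‖x‖
    simpa using h0.const_sub x
  exact hJ.mem_of_tendsto hlim (Eventually.of_forall hmem)

lemma wayBelow_of_mul_mul_eq_self {x y k : A} (h : x * y * k = x) :
    WayBelow (genClosedIdeal {x}) (genClosedIdeal {y}) := by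
  intro g hg hmono hle
  have hy := mem_closure_iUnion_of_mem_cSup hmono (hle (mem_genClosedIdeal_singleton y))
  obtain ⟨b, hb, hyb⟩ := Metric.mem_closure_iff.1 hy (1 / (‖k‖ + 1)) (by positivity)
  obtain ⟨n, hn⟩ := Set.mem_iUnion.1 hb
  refine ⟨n, genClosedIdeal_singleton_le (hg n).1 (mem_of_mul_mul_eq_self (hg n).1 h hn ?_)⟩
  rw [dist_eq_norm, lt_div_iff₀ (by positivity)] at hyb
  nlinarith [norm_nonneg (y - b)]

/-- The function `t ↦ (t - ε)₊`. -/
noncomputable def cutoff (ε t : ℝ) : ℝ := max (t - ε) 0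

/-- A continuous function vanishing at `0` which inverts `cutoff δ` on the support of
`cutoff ε`, for `δ < ε`. -/
noncomputable def cutoffInv (δ ε t : ℝ) : ℝ := cutoff δ t / max (cutoff δ t) (ε - δ) ^ 2

@[fun_prop]
lemma continuous_cutoff (ε : ℝ) : Continuous (cutoff ε) := by unfold cutoff; fun_prop

lemma cutoff_apply_zero {ε : ℝ} (hε : 0 ≤ ε) : cutoff ε 0 = 0 := by simpa [cutoff] using hε

lemma continuous_cutoffInv {δ ε : ℝ} (h : δ < ε) : Continuous (cutoffInv δ ε) := by
  unfold cutoffInv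
  refine (continuous_cutoff δ).div (by fun_prop) fun t ↦ ?_
  have : 0 < max (cutoff δ t) (ε - δ) := lt_max_of_lt_right (sub_pos.2 h)
  positivity

lemma cutoffInv_apply_zero {δ : ℝ} (ε : ℝ) (hδ : 0 ≤ δ) : cutoffInv δ ε 0 = 0 := by
  simp [cutoffInv, cutoff_apply_zero hδ]

lemma cutoff_mul_cutoffInv_of_le {δ ε t : ℝ} (h : δ < ε) (ht : ε ≤ t) :
    cutoff δ t * cutoffInv δ ε t = 1 := by
  have h1 : cutoff δ t = t - δ := max_eq_left (by linarith)
  have h2 : t - δ ≠ 0 := by linarith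
  rw [cutoffInv, h1, max_eq_left (by linarith)]
  field_simp

lemma cutoff_mul_cutoff_mul_cutoffInv {δ ε : ℝ} (h : δ < ε) (t : ℝ) :
    cutoff ε t * cutoff δ t * cutoffInv δ ε t = cutoff ε t := by
  rcases le_total ε t with ht | ht
  · rw [mul_assoc, cutoff_mul_cutoffInv_of_le h ht, mul_one]
  · simp [cutoff, max_eq_right (sub_nonpos.2 ht)]

lemma cutoff_mul_cutoffInv_mem_Icc {δ ε : ℝ} (h : δ < ε) (t : ℝ) :
    cutoff δ t * cutoffInv δ ε t ∈ Set.Icc 0 1 := by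
  have h0 : 0 ≤ cutoff δ t := le_max_right _ _
  have hpos : 0 < max (cutoff δ t) (ε - δ) := lt_max_of_lt_right (sub_pos.2 h)
  have hle := le_max_left (cutoff δ t) (ε - δ)
  rw [cutoffInv, mul_div_assoc', Set.mem_Icc]
  refine ⟨by positivity, (div_le_one (by positivity)).2 ?_⟩
  nlinarith

lemma cfcₙ_cutoff_mul_mul {c : A} {δ ε : ℝ} (hδ : 0 ≤ δ) (h : δ < ε) :
    cfcₙ (cutoff ε) c * cfcₙ (cutoff δ) c * cfcₙ (cutoffInv δ ε) c = cfcₙ (cutoff ε) c := by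
  have h1 := (continuous_cutoffInv h).continuousOn (s := quasispectrum ℝ c)
  have h2 := cutoffInv_apply_zero ε hδ
  have h3 := cutoff_apply_zero hδ
  have h4 := cutoff_apply_zero (hδ.trans h.le)
  have h5 := (continuous_cutoff ε).continuousOn (s := quasispectrum ℝ c)
  have h6 := (continuous_cutoff δ).continuousOn (s := quasispectrum ℝ c)
  rw [← cfcₙ_mul (cutoff ε) (cutoff δ) c h5 h4 h6 h3,
    ← cfcₙ_mul (fun t ↦ cutoff ε t * cutoff δ t) _ c (h5.mul h6) (by simp [h3]) h1 h2]
  exact cfcₙ_congr fun t _ ↦ cutoff_mul_cutoff_mul_cutoffInv h t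

section FunctionalCalculus

variable [PartialOrder A] [StarOrderedRing A]

lemma cfcₙ_cutoff_zero {c : A} (hc : 0 ≤ c) : cfcₙ (cutoff 0) c = c := by
  conv_rhs => rw [← cfcₙ_id' ℝ c]
  refine cfcₙ_congr fun t ht ↦ ?_
  simpa [cutoff] using quasispectrum_nonneg_of_nonneg c hc t ht

lemma norm_cfcₙ_cutoff_sub_le {c : A} (hc : 0 ≤ c) {ε : ℝ} (hε : 0 ≤ ε) :
    ‖c - cfcₙ (cutoff ε) c‖ ≤ ε := by
  have h4 := cutoff_apply_zero hε
  have h5 := (continuous_cutoff ε).continuousOn (s := quasispectrum ℝ c)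
  conv_lhs => enter [1, 1]; rw [← cfcₙ_id' ℝ c]
  rw [← cfcₙ_sub (fun t : ℝ ↦ t) (cutoff ε) c continuousOn_id rfl h5 h4]
  refine norm_cfcₙ_le fun t ht ↦ ?_
  have h0 := quasispectrum_nonneg_of_nonneg c hc t ht
  rw [Real.norm_eq_abs, abs_le, cutoff]
  rcases max_cases (t - ε) 0 with h | h <;> constructor <;> linarith

/-- A positive element has local approximate units in the ideal it generates. -/
lemma exists_mem_norm_le {c : A} (hc : 0 ≤ c) {ε : ℝ} (hε : 0 < ε) :
    ∃ u : A, IsSelfAdjoint u ∧ (∀ J : TwoSidedIdeal A, c ∈ J → u ∈ J) ∧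
      ‖c - c * u - u * c + u * c * u‖ ≤ ε := by
  have h1 := (continuous_cutoffInv hε).continuousOn (s := quasispectrum ℝ c)
  have h2 := cutoffInv_apply_zero ε le_rfl
  have h3 := cutoff_apply_zero le_rfl
  have h6 := (continuous_cutoff 0).continuousOn (s := quasispectrum ℝ c)
  obtain ⟨v, hv⟩ : ∃ v : ℝ → ℝ, v = fun t ↦ cutoff 0 t * cutoffInv 0 ε t := ⟨_, rfl⟩
  have hvc : ContinuousOn v (quasispectrum ℝ c) := hv ▸ h6.mul h1
  have hv0 : v 0 = 0 := by simp [hv, h3]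
  refine ⟨cfcₙ v c, cfcₙ_predicate v c, fun J hJ ↦ ?_, ?_⟩
  · rw [hv, cfcₙ_mul _ _ c h6 h3 h1 h2, cfcₙ_cutoff_zero hc]
    exact J.mul_mem_right _ _ hJ
  · have key : c - c * cfcₙ v c - cfcₙ v c * c + cfcₙ v c * c * cfcₙ v c =
        cfcₙ (fun t ↦ t - t * v t - v t * t + v t * t * v t) c := by
      rw [cfcₙ_add (fun t ↦ t - t * v t - v t * t) (fun t ↦ v t * t * v t) c,
        cfcₙ_sub (fun t ↦ t - t * v t) (fun t ↦ v t * t) c,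
        cfcₙ_sub (fun t ↦ t) (fun t ↦ t * v t) c, cfcₙ_mul (fun t ↦ v t * t) v c,
        cfcₙ_mul v (fun t ↦ t) c, cfcₙ_mul (fun t ↦ t) v c, cfcₙ_id' ℝ c]
    rw [key]
    refine norm_cfcₙ_le fun t ht ↦ ?_
    have h0 := quasispectrum_nonneg_of_nonneg c hc t ht
    have hvt : v t ∈ Set.Icc 0 1 := hv ▸ cutoff_mul_cutoffInv_mem_Icc hε t
    have heq : t - t * v t - v t * t + v t * t * v t = t * (1 - v t) ^ 2 := by ring
    rw [heq, Real.norm_of_nonneg (by positivity)]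
    rcases le_total ε t with h | h
    · have : v t = 1 := hv ▸ cutoff_mul_cutoffInv_of_le hε h
      simpa [this] using hε.le
    · have h7 : (1 - v t) ^ 2 ≤ 1 := by nlinarith [hvt.1, hvt.2]
      nlinarith

/-- Closed ideals are hereditary. -/
lemma mem_of_star_mul_self_le {J : TwoSidedIdeal A} (hJ : IsClosed (J : Set A)) {x c : A} {r : ℝ}
    (hr : 0 ≤ r) (hc : 0 ≤ c) (hcJ : c ∈ J) (hx : star x * x ≤ r • c) : x ∈ J := by
  refine hJ.closure_subset (Metric.mem_closure_iff.2 fun η hη ↦ ?_)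
  obtain ⟨u, hu, huJ, hle⟩ := exists_mem_norm_le hc (ε := η ^ 2 / (r + 1)) (by positivity)
  refine ⟨x * u, J.mul_mem_left _ _ (huJ J hcJ), ?_⟩
  obtain ⟨z, hz⟩ := CStarAlgebra.nonneg_iff_eq_star_mul_self.1 (sub_nonneg.2 hx)
  have hexp (w : A) : star (w - w * u) * (w - w * u) =
      star w * w - star w * w * u - u * (star w * w) + u * (star w * w) * u := by
    simp only [star_sub, star_mul, hu.star_eq]
    noncomm_ring
  have hord : star (x - x * u) * (x - x * u) ≤ r • (c - c * u - u * c + u * c * u) := by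
    have h := star_mul_self_nonneg (z - z * u)
    rw [hexp, ← hz] at h
    rw [hexp, ← sub_nonneg]
    convert h using 1
    simp only [smul_add, smul_sub, mul_sub, sub_mul, smul_mul_assoc, mul_smul_comm]
    abel
  have hn := CStarAlgebra.norm_le_norm_of_nonneg_of_le (star_mul_self_nonneg _) hord
  rw [CStarRing.norm_star_mul_self, norm_smul, Real.norm_of_nonneg hr] at hn
  have hlt : r * (η ^ 2 / (r + 1)) < η ^ 2 := by
    rw [mul_div_assoc', div_lt_iff₀ (by positivity)]
    nlinarith [pow_pos hη 2]
  rw [dist_eq_norm]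
  have := mul_le_mul_of_nonneg_left hle hr
  exact abs_lt_of_sq_lt_sq' (by nlinarith) hη.le |>.2

lemma genClosedIdeal_star_mul_self (a : A) :
    genClosedIdeal {star a * a} = genClosedIdeal {a} := by
  refine le_antisymm (genClosedIdeal_singleton_le (isClosed_genClosedIdeal _)
    (mul_mem_left _ _ _ (mem_genClosedIdeal_singleton a)))
    (genClosedIdeal_singleton_le (isClosed_genClosedIdeal _) ?_)
  exact mem_of_star_mul_self_le (isClosed_genClosedIdeal _) zero_le_one (star_mul_self_nonneg a)
    (mem_genClosedIdeal_singleton _) (one_smul ℝ (star a * a)).ge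

end FunctionalCalculus

lemma MemIdealSigma.cSup {f : ℕ → TwoSidedIdeal A} (hf : ∀ n, MemIdealSigma (f n)) :
    MemIdealSigma (cSup f) := by
  let _ := CStarAlgebra.spectralOrder A
  let _ := CStarAlgebra.spectralOrderedRing A
  choose a ha hfa using fun n ↦ (hf n).2
  let w : ℕ → ℝ := fun n ↦ (1 / 2) ^ n / (1 + ‖star (a n) * a n‖)
  have hw (n : ℕ) : 0 < w n := by positivity
  let s : ℕ → A := fun n ↦ w n • (star (a n) * a n)
  have hs0 (n : ℕ) : 0 ≤ s n := smul_nonneg (hw n).le (star_mul_self_nonneg _)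
  have hs : Summable s := by
    refine Summable.of_norm_bounded summable_geometric_two fun n ↦ ?_
    rw [norm_smul, Real.norm_of_nonneg (hw n).le, div_mul_eq_mul_div,
      div_le_iff₀ (by positivity)]
    gcongr
    linarith
  have hle (n : ℕ) : s n ≤ ∑' n, s n := hs.le_tsum n fun m _ ↦ hs0 m
  have hmem : ∑' n, s n ∈ _root_.cSup f := by
    refine (isClosed_genClosedIdeal _).mem_of_tendsto hs.hasSum.tendsto_sum_nat
      (Eventually.of_forall fun n ↦ sum_mem fun i _ ↦ le_cSup f i ?_)
    simp only [s, ← smul_mul_assoc]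
    exact mul_mem_left _ _ _ (ha i)
  refine ⟨isClosed_genClosedIdeal _, _, hmem, le_antisymm
    (genClosedIdeal_singleton_le (isClosed_genClosedIdeal _) hmem)
    (cSup_le (isClosed_genClosedIdeal _) fun n ↦ ?_)⟩
  rw [← hfa n]
  refine genClosedIdeal_singleton_le (isClosed_genClosedIdeal _) (mem_of_star_mul_self_le
    (isClosed_genClosedIdeal _) (inv_nonneg.2 (hw n).le) (tsum_nonneg hs0)
    (mem_genClosedIdeal_singleton _) ?_)
  calc star (a n) * a n = (w n)⁻¹ • s n := (inv_smul_smul₀ (hw n).ne' _).symm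
    _ ≤ (w n)⁻¹ • ∑' n, s n := smul_le_smul_of_nonneg_left (hle n) (inv_nonneg.2 (hw n).le)

lemma MemIdealSigma.cAdd {I J : TwoSidedIdeal A} (hI : MemIdealSigma I) (hJ : MemIdealSigma J) :
    MemIdealSigma (cAdd I J) := by
  let f : ℕ → TwoSidedIdeal A := fun n ↦ if n = 0 then I else J
  have hf (n : ℕ) : MemIdealSigma (f n) := by
    by_cases h : n = 0 <;> simp [f, h, hI, hJ]
  have heq : _root_.cAdd I J = _root_.cSup f := by
    refine le_antisymm (cAdd_le (isClosed_genClosedIdeal _) ?_ ?_)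
      (cSup_le (isClosed_genClosedIdeal _) fun n ↦ ?_)
    · exact le_cSup f 0
    · exact le_cSup f 1
    · by_cases h : n = 0
      · simpa [f, h] using le_cAdd_left I J
      · simpa [f, h] using le_cAdd_right I J
  exact heq ▸ MemIdealSigma.cSup hf

lemma MemIdealSigma.exists_wayBelow_sequence {I : TwoSidedIdeal A} (hI : MemIdealSigma I) :
    ∃ f : ℕ → TwoSidedIdeal A, (∀ n, MemIdealSigma (f n)) ∧ Monotone f ∧
      (∀ n, WayBelow (f n) (f (n + 1))) ∧ _root_.cSup f = I := by
  let _ := CStarAlgebra.spectralOrder A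
  let _ := CStarAlgebra.spectralOrderedRing A
  obtain ⟨-, a, -, rfl⟩ := hI
  rw [← genClosedIdeal_star_mul_self]
  set c := star a * a
  have hc : 0 ≤ c := star_mul_self_nonneg a
  let ε : ℕ → ℝ := fun n ↦ 1 / ((n : ℝ) + 1)
  have hε (n : ℕ) : 0 < ε n := by positivity
  have hlt (n : ℕ) : ε (n + 1) < ε n :=
    one_div_lt_one_div_of_lt (by positivity) (by push_cast; linarith)
  let x : ℕ → A := fun n ↦ cfcₙ (cutoff (ε n)) c
  have hx (n : ℕ) : x n * x (n + 1) * cfcₙ (cutoffInv (ε (n + 1)) (ε n)) c = x n :=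
    cfcₙ_cutoff_mul_mul (hε _).le (hlt n)
  refine ⟨fun n ↦ genClosedIdeal {x n}, fun n ↦ memIdealSigma_genClosedIdeal_singleton _,
    monotone_nat_of_le_succ fun n ↦ ?_, fun n ↦ wayBelow_of_mul_mul_eq_self (hx n), ?_⟩
  · refine genClosedIdeal_singleton_le (isClosed_genClosedIdeal _) ?_
    rw [← hx n]
    exact mul_mem_right _ _ _ (mul_mem_left _ _ _ (mem_genClosedIdeal_singleton _))
  · refine le_antisymm (cSup_le (isClosed_genClosedIdeal _) fun n ↦
      genClosedIdeal_singleton_le (isClosed_genClosedIdeal _) ?_)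
      (genClosedIdeal_singleton_le (isClosed_genClosedIdeal _) ?_)
    · have h := cfcₙ_cutoff_mul_mul (c := c) le_rfl (hε n)
      rw [cfcₙ_cutoff_zero hc] at h
      simp only [x]
      rw [← h]
      exact mul_mem_right _ _ _ (mul_mem_left _ _ _ (mem_genClosedIdeal_singleton _))
    · have hlim : Tendsto x atTop (𝓝 c) := by
        rw [tendsto_iff_norm_sub_tendsto_zero]
        refine squeeze_zero (fun _ ↦ norm_nonneg _) (fun n ↦ ?_)
          tendsto_one_div_add_atTop_nhds_zero_nat
        rw [norm_sub_rev]
        exact norm_cfcₙ_cutoff_sub_le hc (hε n).le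
      exact (isClosed_genClosedIdeal _).mem_of_tendsto hlim (Eventually.of_forall fun n ↦
        le_cSup (fun n ↦ genClosedIdeal {x n}) n (mem_genClosedIdeal_singleton _))

lemma WayBelow.cAdd {x x' y y' : TwoSidedIdeal A} (hx : WayBelow x x') (hy : WayBelow y y') :
    WayBelow (cAdd x y) (cAdd x' y') := by
  intro g hg hmono hle
  obtain ⟨n, hn⟩ := hx g hg hmono ((le_cAdd_left _ _).trans hle)
  obtain ⟨m, hm⟩ := hy g hg hmono ((le_cAdd_right _ _).trans hle)
  exact ⟨max n m, cAdd_le (hg _).1 (hn.trans (hmono (le_max_left n m)))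
    (hm.trans (hmono (le_max_right n m)))⟩

lemma cAdd_cSup_cSup (f g : ℕ → TwoSidedIdeal A) :
    cAdd (cSup f) (cSup g) = cSup fun n ↦ cAdd (f n) (g n) := by
  have hcl {s : Set A} := isClosed_genClosedIdeal s
  refine le_antisymm (cAdd_le hcl (cSup_le hcl fun n ↦ ?_) (cSup_le hcl fun n ↦ ?_))
    (cSup_le hcl fun n ↦ cAdd_le hcl ?_ ?_)
  · exact (le_cAdd_left (f n) (g n)).trans (le_cSup (fun n ↦ cAdd (f n) (g n)) n)
  · exact (le_cAdd_right (f n) (g n)).trans (le_cSup (fun n ↦ cAdd (f n) (g n)) n)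
  · exact (le_cSup f n).trans (le_cAdd_left _ _)
  · exact (le_cSup g n).trans (le_cAdd_right _ _)

/-- `I_σ(A)`, the set of closed two-sided ideals of a C*-algebra containing a full element,
ordered by inclusion and with addition `I + J`, is an abstract Cuntz semigroup. -/
theorem idealSigma_is_abstract_cuntz_semigroup :
    -- closed under addition (so it is a positively ordered monoid)
    (∀ I J : TwoSidedIdeal A, MemIdealSigma I → MemIdealSigma J → MemIdealSigma (cAdd I J)) ∧
    -- (1) increasing sequences admit suprema in `I_σ(A)`
    (∀ f : ℕ → TwoSidedIdeal A, (∀ n, MemIdealSigma (f n)) → Monotone f →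
      MemIdealSigma (cSup f) ∧ (∀ n, f n ≤ cSup f) ∧
        ∀ J : TwoSidedIdeal A, MemIdealSigma J → (∀ n, f n ≤ J) → cSup f ≤ J) ∧
    -- (2) every element is the supremum of a rapidly increasing sequence
    (∀ I : TwoSidedIdeal A, MemIdealSigma I →
      ∃ f : ℕ → TwoSidedIdeal A, (∀ n, MemIdealSigma (f n)) ∧ Monotone f ∧
        (∀ n, WayBelow (f n) (f (n + 1))) ∧ cSup f = I) ∧
    -- (3) the way-below relation is compatible with addition
    (∀ x x' y y' : TwoSidedIdeal A, MemIdealSigma x → MemIdealSigma x' →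
      MemIdealSigma y → MemIdealSigma y' → WayBelow x x' → WayBelow y y' →
        WayBelow (cAdd x y) (cAdd x' y')) ∧
    -- (4) suprema of increasing sequences are compatible with addition
    (∀ f g : ℕ → TwoSidedIdeal A, (∀ n, MemIdealSigma (f n)) → (∀ n, MemIdealSigma (g n)) →
      Monotone f → Monotone g →
        cAdd (cSup f) (cSup g) = cSup (fun n => cAdd (f n) (g n))) := by
  exact ⟨fun _ _ hI hJ ↦ hI.cAdd hJ,
    fun f hf _ ↦ ⟨.cSup hf, le_cSup f, fun _ hJ h ↦ cSup_le hJ.1 h⟩,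
    fun _ hI ↦ hI.exists_wayBelow_sequence,
    fun _ _ _ _ _ _ _ _ hx hy ↦ hx.cAdd hy,
    fun f g _ _ _ _ ↦ cAdd_cSup_cSup f g⟩
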